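/- Let u be the non-simple Parry word associated with the substitution φ and let h′ = min{ℓ : m ≤ ℓ ≤ m+p−1, α_ℓ ≥ 1}. Define R_ns = h′ + p if α_0 ≥ 2, and R_ns = h′ + m + p − 1 if α_0 = 1. Then φ^{R_ns}(0)·0 is a prefix of u, and every factor of u of the form 0t0 with |t|_0 = 0 is a factor of φ^{R_ns}(0)·0. -/

import Mathlib

/-- The prefix of length `n` of the infinite word `u`. -/
def pref (u : ℕ → ℕ) (n : ℕ) : List ℕ := (List.range n).map u

/-- `w` is a factor of the infinite word `u`. -/
def IsFactor (u : ℕ → ℕ) (w : List ℕ) : Prop :=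
  ∃ i : ℕ, w = (List.range w.length).map (fun j => u (i + j))

/-- The Parikh vector of `w`, viewed as a word over `{0, …, m-1}`. -/
def parikh (m : ℕ) (w : List ℕ) : Fin m → ℤ := fun ℓ => (w.count (ℓ : ℕ) : ℤ)

/-- The set of relative Parikh vectors of factors of `u` of length `n`. -/
def relParikhSet (m : ℕ) (u : ℕ → ℕ) (n : ℕ) : Set (Fin m → ℤ) :=
  { v | ∃ w : List ℕ, IsFactor u w ∧ w.length = n ∧ v = parikh m w - parikh m (pref u n) }

/-- The extension of a substitution `φ` to finite words. -/
def substW (φ : ℕ → List ℕ) (w : List ℕ) : List ℕ := w.flatMap φ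

/-- The `k`-th iterate of the substitution `φ`, applied to the word `w`. -/
def iterW (φ : ℕ → List ℕ) (k : ℕ) (w : List ℕ) : List ℕ := (substW φ)^[k] w

section Gaps

variable {t : List ℕ}

theorem concat_zero_prefix_append {x y : List ℕ} (ht : 0 ∉ t)
    (h : t ++ [0] <+: x ++ 0 :: y) : t ++ [0] <+: x ∨ t = x := by
  induction x generalizing t with
  | nil =>
    cases t with
    | nil => exact Or.inr rfl
    | cons e t => simp_all [List.cons_prefix_cons]
  | cons d x ih =>
    cases t with
    | nil =>
      left
      simpa [List.cons_prefix_cons] using h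
    | cons e t =>
      simp only [List.cons_append, List.cons_prefix_cons] at h ⊢
      obtain ⟨rfl, h⟩ := h
      rcases ih (fun h0 => ht (List.mem_cons_of_mem _ h0)) h with h | h
      · exact Or.inl ⟨rfl, h⟩
      · exact Or.inr (by rw [h])

/-- A block `0t0` with `t` free of zeros lies on one side of a zero, or ends at it. -/
theorem gap_infix_append {x y : List ℕ} (ht : 0 ∉ t)
    (h : 0 :: (t ++ [0]) <:+: x ++ 0 :: y) :
    0 :: (t ++ [0]) <:+: x ∨ 0 :: t <:+ x ∨ 0 :: (t ++ [0]) <:+: 0 :: y := by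
  induction x with
  | nil => exact Or.inr (Or.inr h)
  | cons c x ih =>
    rw [List.cons_append, List.infix_cons_iff] at h
    rcases h with h | h
    · rw [List.cons_prefix_cons] at h
      obtain ⟨rfl, h⟩ := h
      rcases concat_zero_prefix_append ht h with h | rfl
      · exact Or.inl (List.prefix_cons_inj _ |>.2 h).isInfix
      · exact Or.inr (Or.inl List.suffix_rfl)
    · rcases ih h with h | h | h
      · exact Or.inl (List.infix_cons h)
      · exact Or.inr (Or.inl (h.trans (List.suffix_cons _ _)))
      · exact Or.inr (Or.inr h)

theorem gap_infix_concat {x : List ℕ} {b : ℕ} (hb : b ≠ 0)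
    (h : 0 :: (t ++ [0]) <:+: x ++ [b]) : 0 :: (t ++ [0]) <:+: x := by
  rw [List.infix_concat_iff] at h
  rcases h with h | h
  · obtain ⟨s, hs⟩ := h
    rw [← List.cons_append, ← List.append_assoc] at hs
    have := (List.append_inj' hs rfl).2
    simp_all
  · exact h

theorem gap_infix_flatten_replicate {z y : List ℕ} (ht : 0 ∉ t)
    (hz : ∃ w, z = 0 :: w) (hy : y ≠ [] → ∃ w, y = 0 :: w) (c : ℕ)
    (h : 0 :: (t ++ [0]) <:+: (List.replicate c z).flatten ++ y) :
    (1 ≤ c ∧ (0 :: (t ++ [0]) <:+: z ∨ 0 :: t <:+ z ∧ (2 ≤ c ∨ y ≠ []))) ∨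
      0 :: (t ++ [0]) <:+: y := by
  induction c with
  | zero => exact Or.inr (by simpa using h)
  | succ c ih =>
    rw [List.replicate_succ, List.flatten_cons, List.append_assoc] at h
    by_cases hc : c = 0 ∧ y = []
    · obtain ⟨rfl, rfl⟩ := hc
      exact Or.inl ⟨le_rfl, Or.inl (by simpa using h)⟩
    have hc' : 2 ≤ c + 1 ∨ y ≠ [] := by
      by_cases hy0 : y = []
      · left; have : c ≠ 0 := fun h0 => hc ⟨h0, hy0⟩
        omega
      · exact Or.inr hy0
    obtain ⟨v, hv⟩ : ∃ v, (List.replicate c z).flatten ++ y = 0 :: v := by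
      obtain ⟨w, rfl⟩ := hz
      rcases c with _ | c
      · simpa using hy (fun h0 => hc ⟨rfl, h0⟩)
      · exact ⟨_, by rw [List.replicate_succ, List.flatten_cons, List.append_assoc,
          List.cons_append]⟩
    have h2 := h
    rw [hv] at h2
    rcases gap_infix_append ht h2 with h2 | h2 | h2
    · exact Or.inl ⟨by omega, Or.inl h2⟩
    · exact Or.inl ⟨by omega, Or.inr ⟨h2, hc'⟩⟩
    · rw [← hv] at h2
      rcases ih h2 with ⟨h1, h3 | ⟨h3, h4⟩⟩ | h3
      · exact Or.inl ⟨by omega, Or.inl h3⟩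
      · exact Or.inl ⟨by omega, Or.inr ⟨h3, hc'⟩⟩
      · exact Or.inr h3

theorem gap_infix_of_suffix {z w : List ℕ} (hs : 0 :: t <:+ z) (hz : z ++ [0] <:+: w) :
    0 :: (t ++ [0]) <:+: w := by
  obtain ⟨s, rfl⟩ := hs
  exact List.IsInfix.trans ⟨s, [], by simp⟩ hz

/-- The last zero of a word is contained in each of its suffixes that starts with a zero. -/
theorem cons_zero_suffix_of_suffix {x w : List ℕ} (ht : 0 ∉ t) (h : 0 :: t <:+ x)
    (hw : 0 :: w <:+ x) : 0 :: t <:+ 0 :: w := by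
  rcases List.suffix_or_suffix_of_suffix h hw with h1 | h1
  · exact h1
  · rcases List.suffix_cons_iff.1 h1 with h2 | h2
    · rw [h2]
    · exact absurd (h2.subset List.mem_cons_self) ht

end Gaps

/-- The `k`-th iterate of a substitution at the letter `o i`, for a substitution mapping `o i` to
`0 ^ (a i) ⬝ o (i + 1)` where `o 0 = 0`. -/
def orbitWord (a o : ℕ → ℕ) : ℕ → ℕ → List ℕ
  | 0, i => [o i]
  | k + 1, i => (List.replicate (a i) (orbitWord a o k 0)).flatten ++ orbitWord a o k (i + 1)

theorem iterW_append (φ : ℕ → List ℕ) (k : ℕ) (x y : List ℕ) :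
    iterW φ k (x ++ y) = iterW φ k x ++ iterW φ k y := by
  induction k generalizing x y with
  | zero => rfl
  | succ k ih =>
    have h : ∀ w, iterW φ (k + 1) w = iterW φ k (w.flatMap φ) := fun w => rfl
    rw [h, h, h, List.flatMap_append, ih]

theorem iterW_replicate (φ : ℕ → List ℕ) (k c b : ℕ) :
    iterW φ k (List.replicate c b) = (List.replicate c (iterW φ k [b])).flatten := by
  induction c with
  | zero =>
    induction k with
    | zero => rfl
    | succ k ih => exact ih
  | succ c ih =>
    rw [List.replicate_succ, List.replicate_succ, List.flatten_cons, ← ih, ← iterW_append]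
    rfl

theorem iterW_eq_orbitWord {φ : ℕ → List ℕ} {a o : ℕ → ℕ} (o0 : o 0 = 0)
    (h : ∀ i, φ (o i) = List.replicate (a i) 0 ++ [o (i + 1)]) (k i : ℕ) :
    iterW φ k [o i] = orbitWord a o k i := by
  induction k generalizing i with
  | zero => rfl
  | succ k ih =>
    have h1 : iterW φ (k + 1) [o i] = iterW φ k (φ (o i)) := by
      change iterW φ k ([o i].flatMap φ) = _
      simp
    rw [h1, h, iterW_append, iterW_replicate, ih, orbitWord, ← ih 0, o0]

section OrbitWord

variable {a o : ℕ → ℕ}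

theorem orbitWord_suffix (i k l : ℕ) : orbitWord a o k (l + i) <:+ orbitWord a o (i + k) l := by
  induction i generalizing l with
  | zero => simp
  | succ i ih =>
    have := ih (l + 1)
    rw [show l + (i + 1) = l + 1 + i by omega, show i + 1 + k = i + k + 1 by omega, orbitWord]
    exact this.trans (List.suffix_append _ _)

theorem orbitWord_eq_singleton (k i : ℕ) (h : ∀ j < k, a (i + j) = 0) :
    orbitWord a o k i = [o (i + k)] := by
  induction k generalizing i with
  | zero => rfl
  | succ k ih =>
    have h0 : a i = 0 := h 0 (by omega)
    rw [orbitWord, h0, ih (i + 1) (fun j hj => by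
      rw [show i + 1 + j = i + (j + 1) by omega]; exact h _ (by omega))]
    simp [show i + 1 + k = i + (k + 1) by omega]

theorem orbitWord_zero_eq_cons (o0 : o 0 = 0) (a0 : 1 ≤ a 0) (k : ℕ) :
    ∃ w, orbitWord a o k 0 = 0 :: w := by
  induction k with
  | zero => exact ⟨[], by rw [orbitWord, o0]⟩
  | succ k ih =>
    obtain ⟨w, hw⟩ := ih
    obtain ⟨c, hc⟩ : ∃ c, a 0 = c + 1 := ⟨a 0 - 1, by omega⟩
    exact ⟨_, by rw [orbitWord, hc, hw, List.replicate_succ, List.flatten_cons,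
      List.append_assoc, List.cons_append]⟩

theorem orbitWord_eq_cons (o0 : o 0 = 0) (a0 : 1 ≤ a 0) {k i j : ℕ} (hj : j < k)
    (ha : 1 ≤ a (i + j)) : ∃ w, orbitWord a o k i = 0 :: w := by
  induction k generalizing i j with
  | zero => omega
  | succ k ih =>
    by_cases hi : a i = 0
    · rw [orbitWord, hi]
      rcases j with _ | j
      · simp_all
      · simpa using ih (i := i + 1) (j := j) (by omega)
          (by rwa [show i + 1 + j = i + (j + 1) by omega])
    · obtain ⟨w, hw⟩ := orbitWord_zero_eq_cons o0 a0 k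
      obtain ⟨c, hc⟩ : ∃ c, a i = c + 1 := ⟨a i - 1, by omega⟩
      exact ⟨_, by rw [orbitWord, hc, hw, List.replicate_succ, List.flatten_cons,
        List.append_assoc, List.cons_append]⟩

theorem orbitWord_prefix_succ (a0 : 1 ≤ a 0) (k : ℕ) :
    orbitWord a o k 0 <+: orbitWord a o (k + 1) 0 := by
  obtain ⟨c, hc⟩ : ∃ c, a 0 = c + 1 := ⟨a 0 - 1, by omega⟩
  rw [orbitWord, hc, List.replicate_succ, List.flatten_cons, List.append_assoc]
  exact List.prefix_append _ _

theorem orbitWord_prefix (a0 : 1 ≤ a 0) {k l : ℕ} (h : k ≤ l) :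
    orbitWord a o k 0 <+: orbitWord a o l 0 := by
  induction l, h using Nat.le_induction with
  | base => exact List.prefix_rfl
  | succ l _ ih => exact ih.trans (orbitWord_prefix_succ a0 l)

theorem orbitWord_ne_nil (k i : ℕ) : orbitWord a o k i ≠ [] := by
  induction k generalizing i with
  | zero => simp [orbitWord]
  | succ k ih => simp [orbitWord, ih]

theorem lt_length_orbitWord (a0 : 1 ≤ a 0) (k : ℕ) : k < (orbitWord a o k 0).length := by
  induction k with
  | zero => simp [orbitWord]
  | succ k ih =>
    have h1 := List.length_pos_of_ne_nil (orbitWord_ne_nil (a := a) (o := o) k 1)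
    have h2 : (orbitWord a o k 0).length ≤ a 0 * (orbitWord a o k 0).length :=
      Nat.le_mul_of_pos_left _ a0
    simp only [orbitWord, List.length_append, List.length_flatten, List.map_replicate,
      List.sum_replicate, smul_eq_mul, zero_add]
    omega

theorem orbitWord_concat_zero_prefix (o0 : o 0 = 0) (a0 : 1 ≤ a 0) {k j : ℕ} (hj : j < k)
    (ha : 1 ≤ a (1 + j)) : orbitWord a o k 0 ++ [0] <+: orbitWord a o (k + 1) 0 := by
  obtain ⟨w, hw⟩ := orbitWord_eq_cons o0 a0 hj ha
  obtain ⟨v, hv⟩ := orbitWord_zero_eq_cons o0 a0 k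
  obtain ⟨c, hc⟩ : ∃ c, a 0 = c + 1 := ⟨a 0 - 1, by omega⟩
  rw [orbitWord, hc, List.replicate_succ, List.flatten_cons, List.append_assoc,
    List.prefix_append_right_inj]
  rcases c with _ | c
  · simp [hw]
  · rw [List.replicate_succ, List.flatten_cons, hv]
    simp

theorem orbitWord_concat_zero_prefix_of_two_le (o0 : o 0 = 0) (a0 : 2 ≤ a 0) (k : ℕ) :
    orbitWord a o k 0 ++ [0] <+: orbitWord a o (k + 1) 0 := by
  obtain ⟨v, hv⟩ := orbitWord_zero_eq_cons (a := a) o0 (by omega) k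
  obtain ⟨c, hc⟩ : ∃ c, a 0 = c + 1 + 1 := ⟨a 0 - 2, by omega⟩
  rw [orbitWord, hc, List.replicate_succ, List.flatten_cons, List.append_assoc,
    List.prefix_append_right_inj, List.replicate_succ, List.flatten_cons, hv]
  simp

theorem orbitWord_concat_zero_infix (o0 : o 0 = 0) (a0 : 1 ≤ a 0) {i q l j : ℕ}
    (hi : 1 ≤ a (l + i)) (hj : j < q) (ha : 1 ≤ a (l + i + 1 + j)) :
    orbitWord a o q 0 ++ [0] <:+: orbitWord a o (i + (q + 1)) l := by
  obtain ⟨w, hw⟩ := orbitWord_eq_cons o0 a0 hj ha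
  obtain ⟨c, hc⟩ : ∃ c, a (l + i) = c + 1 := ⟨a (l + i) - 1, by omega⟩
  refine List.IsInfix.trans ?_ (orbitWord_suffix i (q + 1) l).isInfix
  rw [orbitWord, hc, List.replicate_succ', List.flatten_append, hw]
  exact ⟨(List.replicate c (orbitWord a o q 0)).flatten, w, by simp⟩

/-- Where a block `0t0` of an iterate comes from. -/
theorem exists_of_gap_infix_orbitWord (o0 : o 0 = 0) (o1 : ∀ i, o (i + 1) ≠ 0) (a0 : 1 ≤ a 0)
    {t : List ℕ} (ht : 0 ∉ t) {k l : ℕ} (h : 0 :: (t ++ [0]) <:+: orbitWord a o k l) :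
    ∃ i q, k = i + (q + 1) ∧ 1 ≤ a (l + i) ∧ (0 :: (t ++ [0]) <:+: orbitWord a o q 0 ∨
      0 :: t <:+ orbitWord a o q 0 ∧
        (2 ≤ a (l + i) ∨ ∃ j < q, 1 ≤ a (l + i + 1 + j))) := by
  induction k generalizing l with
  | zero => have := h.length_le; simp [orbitWord] at this
  | succ k ih =>
    have hz := orbitWord_zero_eq_cons o0 a0 k
    rw [orbitWord] at h
    by_cases hk : ∃ j < k, 1 ≤ a (l + 1 + j)
    · obtain ⟨j, hj, hja⟩ := hk
      rcases gap_infix_flatten_replicate ht hz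
        (fun _ => orbitWord_eq_cons o0 a0 hj hja) _ h with ⟨h1, h2⟩ | h2
      · refine ⟨0, k, by omega, h1, h2.imp_right fun h3 => ⟨h3.1, Or.inr ⟨j, hj, hja⟩⟩⟩
      · obtain ⟨i, q, rfl, h3, h4⟩ := ih h2
        refine ⟨i + 1, q, by omega, ?_, ?_⟩
        · rwa [show l + (i + 1) = l + 1 + i by omega]
        · rwa [show l + (i + 1) = l + 1 + i by omega]
    · push Not at hk
      rw [orbitWord_eq_singleton k (l + 1) (fun j hj => by have := hk j hj; omega)] at h
      replace h := gap_infix_concat (by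
        rw [show l + 1 + k = l + k + 1 by omega]; exact o1 _) h
      rw [← List.append_nil (List.flatten _)] at h
      rcases gap_infix_flatten_replicate ht hz (fun h0 => absurd rfl h0) _ h with ⟨h1, h2⟩ | h2
      · exact ⟨0, k, by omega, h1, h2.imp_right fun h3 => ⟨h3.1, Or.inl
          (h3.2.resolve_right fun h0 => h0 rfl)⟩⟩
      · simp at h2

variable {m p r : ℕ}

theorem cons_zero_suffix_orbitWord_add_period (o0 : o 0 = 0) (a0 : 1 ≤ a 0)
    (hper : ∀ k, orbitWord a o k (r + p) = orbitWord a o k r) (hr : 1 ≤ a r)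
    {t : List ℕ} (ht : 0 ∉ t) {n : ℕ} (hn : r < n) (h : 0 :: t <:+ orbitWord a o (n + p) 0) :
    0 :: t <:+ orbitWord a o n 0 := by
  obtain ⟨w, hw⟩ := orbitWord_eq_cons (k := n - r) (i := r) (j := 0) o0 a0 (by omega) hr
  have h1 := orbitWord_suffix (a := a) (o := o) (r + p) (n - r) 0
  have h2 := orbitWord_suffix (a := a) (o := o) r (n - r) 0
  rw [zero_add, hper, show r + p + (n - r) = n + p by omega, hw] at h1
  rw [zero_add, show r + (n - r) = n by omega, hw] at h2
  exact (cons_zero_suffix_of_suffix ht h h1).trans h2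

theorem orbitWord_add_period (ha : ∀ i, m ≤ i → a (i + p) = a i)
    (ho : ∀ i, m ≤ i → o (i + p) = o i) (k : ℕ) {i : ℕ} (hi : m ≤ i) :
    orbitWord a o k (i + p) = orbitWord a o k i := by
  induction k generalizing i with
  | zero => simp [orbitWord, ho i hi]
  | succ k ih =>
    rw [orbitWord, orbitWord, ha i hi, show i + p + 1 = i + 1 + p by omega, ih (by omega)]

/-- Every block `0t0` of an iterate occurs in the `R`-th iterate followed by `0`. -/
theorem gap_infix_orbitWord_concat_zero (hm : 1 ≤ m) (hp : 1 ≤ p)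
    (o0 : o 0 = 0) (o1 : ∀ i, o (i + 1) ≠ 0) (a0 : 1 ≤ a 0) (hale : ∀ i, a i ≤ a 0)
    (ha : ∀ i, m ≤ i → a (i + p) = a i) (ho : ∀ i, m ≤ i → o (i + p) = o i)
    (hmr : m ≤ r) (hr : 1 ≤ a r) {R : ℕ} (hR : r + p ≤ R)
    (hR1 : a 0 = 1 → r + m + p ≤ R + 1) {t : List ℕ} (ht : 0 ∉ t) (n : ℕ)
    (h : 0 :: (t ++ [0]) <:+: orbitWord a o n 0) :
    0 :: (t ++ [0]) <:+: orbitWord a o R 0 ++ [0] := by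
  have step : ∀ q, (2 ≤ a 0 ∨ r ≤ q) →
      orbitWord a o q 0 ++ [0] <+: orbitWord a o (q + 1) 0 := by
    rintro q (hq | hq)
    · exact orbitWord_concat_zero_prefix_of_two_le o0 hq q
    · exact orbitWord_concat_zero_prefix (j := r - 1) o0 a0 (by omega)
        (by rwa [show 1 + (r - 1) = r by omega])
  have small : ∀ q ≤ R, (2 ≤ a 0 ∨ r ≤ q) → 0 :: t <:+ orbitWord a o q 0 →
      0 :: (t ++ [0]) <:+: orbitWord a o R 0 ++ [0] := by
    intro q hq hq2 hs
    rcases hq.eq_or_lt with rfl | hlt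
    · exact gap_infix_of_suffix hs List.infix_rfl
    · exact gap_infix_of_suffix hs (((step q hq2).trans (orbitWord_prefix a0 hlt)).trans
        (List.prefix_append _ _)).isInfix
  have large : ∀ q, r ≤ q → 0 :: t <:+ orbitWord a o q 0 →
      0 :: (t ++ [0]) <:+: orbitWord a o R 0 ++ [0] := by
    intro q
    induction q using Nat.strong_induction_on with
    | _ q ih =>
      intro hq hs
      by_cases hqR : q ≤ R
      · exact small q hqR (Or.inr hq) hs
      · refine ih (q - p) (by omega) (by omega) ?_
        refine cons_zero_suffix_orbitWord_add_period o0 a0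
          (fun k => orbitWord_add_period ha ho k hmr) hr ht (by omega) ?_
        rwa [show q - p + p = q by omega]
  induction n using Nat.strong_induction_on with
  | _ n ih =>
    by_cases hn : n ≤ R
    · exact h.trans ((orbitWord_prefix a0 hn).trans (List.prefix_append _ _)).isInfix
    obtain ⟨i, q, rfl, hi, h1 | ⟨h1, h2⟩⟩ := exists_of_gap_infix_orbitWord o0 o1 a0 ht h
    · exact ih q (by omega) h1
    by_cases hq : r ≤ q
    · exact large q hq h1
    by_cases h02 : 2 ≤ a 0
    · exact small q (by omega) (Or.inl h02) h1
    rw [zero_add] at hi h2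
    obtain ⟨j, hj, hja⟩ := h2.resolve_left (by have := hale i; omega)
    have := hR1 (by omega)
    obtain ⟨i, rfl⟩ : ∃ i', i = i' + p := ⟨i - p, by omega⟩
    refine ih (i + (q + 1)) (by omega) (gap_infix_of_suffix h1 ?_)
    refine orbitWord_concat_zero_infix o0 a0 (j := j) ?_ hj ?_
    · rwa [zero_add, ← ha _ (by omega)]
    · rwa [zero_add, ← ha _ (by omega), show i + 1 + j + p = i + p + 1 + j by omega]

end OrbitWord

theorem pref_of_prefix {u : ℕ → ℕ} {w : List ℕ} {n : ℕ} (h : w <+: pref u n) :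
    w = pref u w.length := by
  have hl : w.length ≤ n := by simpa [pref] using h.length_le
  rw [List.prefix_iff_eq_take] at h
  conv_lhs => rw [h]
  rw [pref, pref, ← List.map_take, List.take_range, min_eq_left hl]

theorem IsFactor.exists_infix_pref {u : ℕ → ℕ} {w : List ℕ} (h : IsFactor u w) :
    ∃ N, ∀ n, N ≤ n → w <:+: pref u n := by
  obtain ⟨i, hi⟩ := h
  refine ⟨i + w.length, fun n hn => ?_⟩
  obtain ⟨c, rfl⟩ := Nat.exists_eq_add_of_le hn
  refine ⟨pref u i, (List.range c).map (fun j => u (i + w.length + j)), ?_⟩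
  rw [pref, pref, List.range_add, List.range_add, List.map_append, List.map_append, List.map_map,
    List.map_map]
  congr 2

/-- The successor of letters under `ℓ ↦ ℓ + 1`, with `m + p - 1 ↦ m`. -/
def nextLetter (m p ℓ : ℕ) : ℕ := if ℓ + 1 < m + p then ℓ + 1 else m

theorem nextLetter_iterate_eq {m p i : ℕ} (hi : i < m + p) : (nextLetter m p)^[i] 0 = i := by
  induction i with
  | zero => rfl
  | succ i ih => rw [Function.iterate_succ_apply', ih (by omega), nextLetter, if_pos hi]

theorem nextLetter_iterate_lt {m p : ℕ} (hp : 1 ≤ p) (i : ℕ) :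
    (nextLetter m p)^[i] 0 < m + p := by
  cases i with
  | zero => simp; omega
  | succ i => rw [Function.iterate_succ_apply', nextLetter]; split_ifs <;> omega

theorem nextLetter_iterate_add_period {m p : ℕ} (hp : 1 ≤ p) {i : ℕ} (hi : m ≤ i) :
    (nextLetter m p)^[i + p] 0 = (nextLetter m p)^[i] 0 := by
  have h : (nextLetter m p)^[m + p] 0 = m := by
    rw [show m + p = (m + p - 1) + 1 by omega, Function.iterate_succ_apply',
      nextLetter_iterate_eq (by omega), nextLetter, if_neg (by omega)]
  obtain ⟨c, rfl⟩ := Nat.exists_eq_add_of_le hi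
  rw [show m + c + p = c + (m + p) by omega, Function.iterate_add_apply, h, add_comm m c,
    Function.iterate_add_apply, nextLetter_iterate_eq (by omega)]

theorem stmt9
    (m p : ℕ) (hm : 1 ≤ m) (hp : 1 ≤ p) (α : ℕ → ℕ) (hα0 : 1 ≤ α 0)
    (hαle : ∀ ℓ, ℓ < m + p → α ℓ ≤ α 0)
    (hαex : ∃ ℓ, m ≤ ℓ ∧ ℓ ≤ m + p - 1 ∧ 1 ≤ α ℓ)
    (φ : ℕ → List ℕ)
    (hφ : ∀ ℓ, ℓ + 1 < m + p → φ ℓ = List.replicate (α ℓ) 0 ++ [ℓ + 1])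
    (hφlast : φ (m + p - 1) = List.replicate (α (m + p - 1)) 0 ++ [m])
    (u : ℕ → ℕ) (hu : ∀ i, u i < m + p)
    (hufix : ∀ k : ℕ, iterW φ k [0] = pref u (iterW φ k [0]).length)
    (h' : ℕ) (hh' : h' = sInf {ℓ : ℕ | m ≤ ℓ ∧ ℓ ≤ m + p - 1 ∧ 1 ≤ α ℓ})
    (R : ℕ) (hR : R = if 2 ≤ α 0 then h' + p else h' + m + p - 1) :
    (iterW φ R [0] ++ [0]) = pref u (iterW φ R [0] ++ [0]).length ∧
    (∀ t : List ℕ, t.count 0 = 0 → IsFactor u ([0] ++ t ++ [0]) →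
      ([0] ++ t ++ [0]) <:+: (iterW φ R [0] ++ [0])) := by
  set o : ℕ → ℕ := fun i => (nextLetter m p)^[i] 0
  set a : ℕ → ℕ := fun i => α (o i) with ha
  have o0 : o 0 = 0 := rfl
  have a0 : 1 ≤ a 0 := hα0
  have hlt : ∀ i, o i < m + p := nextLetter_iterate_lt hp
  have hsucc : ∀ i, o (i + 1) = nextLetter m p (o i) :=
    fun i => Function.iterate_succ_apply' _ _ _
  have o1 : ∀ i, o (i + 1) ≠ 0 := fun i => by
    rw [hsucc, nextLetter]; split_ifs <;> omega
  have hφo : ∀ i, φ (o i) = List.replicate (a i) 0 ++ [o (i + 1)] := fun i => by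
    rw [hsucc, nextLetter]
    have := hlt i
    split_ifs with h
    · exact hφ _ h
    · have hoi : o i = m + p - 1 := by omega
      rw [ha, hoi]
      simpa only [hoi] using hφlast
  have hW : ∀ k, iterW φ k [0] = orbitWord a o k 0 := fun k => iterW_eq_orbitWord o0 hφo k 0
  obtain ⟨hmr, hrp, hr⟩ : m ≤ h' ∧ h' ≤ m + p - 1 ∧ 1 ≤ α h' := by
    rw [hh']; exact Nat.sInf_mem hαex
  have hop : ∀ i, m ≤ i → o (i + p) = o i := fun i hi => nextLetter_iterate_add_period hp hi
  have hr' : 1 ≤ a h' := by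
    change 1 ≤ α ((nextLetter m p)^[h'] 0)
    rwa [nextLetter_iterate_eq (by omega)]
  have hRle : h' + p ≤ R := by rw [hR]; split_ifs <;> omega
  have hR1 : a 0 = 1 → h' + m + p ≤ R + 1 := fun h1 => by
    change α 0 = 1 at h1
    rw [hR, if_neg (by omega)]; omega
  simp only [hW] at hufix ⊢
  constructor
  · have h := orbitWord_concat_zero_prefix (a := a) (o := o) (k := R) (j := h' - 1) o0 a0
      (by omega) (by rwa [show 1 + (h' - 1) = h' by omega])
    rw [hufix (R + 1)] at h
    exact pref_of_prefix h
  · intro t ht hf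
    obtain ⟨N, hN⟩ := hf.exists_infix_pref
    have h := hN _ (lt_length_orbitWord (a := a) (o := o) a0 N).le
    rw [← hufix] at h
    simpa using gap_infix_orbitWord_concat_zero hm hp o0 o1 a0 (fun i => hαle _ (hlt i))
      (fun i hi => by rw [ha]; simp only [hop i hi]) hop hmr hr' hRle hR1
      (List.count_eq_zero.1 ht) N (by simpa using h)
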